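/- arXiv:1901.05367 — 2 statements merged into one kernel-verified Lean document; each statement's English description precedes it below -/
import Mathlib

section
/- (Lemma 3) For any k ∈ ℝ and x ∈ [0,1), as n → ∞, Δ_n(x,k) = (3/(2(n+1+x)²))·(H(x) − k) + o(1/n²); that is, n²·(Δ_n(x,k) − (3/(2(n+1+x)²))·(H(x) − k)) → 0. -/
open MeasureTheory ProbabilityTheory Filter Real Set
open scoped ENNReal NNReal

/-- Distribution of `Z_λ = N_λ + U`, `N_λ` Poisson(λ), `U` uniform on `(0,1)`, independent. -/
noncomputable def zMeasure (l : ℝ) : Measure ℝ :=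
  Measure.map (fun p : ℝ × ℝ => p.1 + p.2)
    ((Measure.map (Nat.cast : ℕ → ℝ) (poissonMeasure l.toNNReal)).prod
      (volume.restrict (Set.Ioo (0 : ℝ) 1)))

/-- The median of `Z_λ`: `inf {t : P(Z_λ ≤ t) ≥ 1/2}`. -/
noncomputable def medianZ (l : ℝ) : ℝ :=
  sInf {t : ℝ | (1 : ℝ≥0∞) / 2 ≤ zMeasure l (Set.Iic t)}

/-- The function `H` of the main theorem. -/
noncomputable def Hfun (x : ℝ) : ℝ :=
  if x ≤ 2 / 3 then x ^ 2 * (x - 1) / 3 + 4 / 135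
  else x / 3 * (x ^ 2 - 4 * x + 5) - 86 / 135

/-- `w_n(x,k) = P(Z_{n+x} ≤ n + x + 1/3 + k/(n+x))`. -/
noncomputable def w (n : ℕ) (x k : ℝ) : ℝ :=
  (zMeasure (n + x) (Set.Iic ((n : ℝ) + x + 1 / 3 + k / (n + x)))).toReal

/-- `r_n(x,k) = k/(n+x)`. -/
noncomputable def r (n : ℕ) (x k : ℝ) : ℝ := k / (n + x)

/-- `g_n(u) = e^{-u} u^n`. -/
noncomputable def g (n : ℕ) (u : ℝ) : ℝ := Real.exp (-u) * u ^ n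

/-- `c_n(v,x) = ((n+v+x)/(n+1+x))^{n+1} e^{1-v}`. -/
noncomputable def c (n : ℕ) (v x : ℝ) : ℝ :=
  (((n : ℝ) + v + x) / ((n : ℝ) + 1 + x)) ^ (n + 1) * Real.exp (1 - v)

/-- `Δ_n(x,k) = ((n+1)!/g_{n+1}(n+1+x)) (w_{n+1}(x,k) - w_n(x,k))`. -/
noncomputable def Δfun (n : ℕ) (x k : ℝ) : ℝ :=
  ((n + 1).factorial : ℝ) / g (n + 1) ((n : ℝ) + 1 + x) * (w (n + 1) x k - w n x k)

/-- The mass `e^{-l} l^j / j!` that the Poisson distribution of parameter `l` gives to `j`. -/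
noncomputable def poissonWeight (l : ℝ) (j : ℕ) : ℝ :=
  Real.exp (-l) * l ^ j / j.factorial

lemma zMeasure_Iic_toReal {l f : ℝ} (hl : 0 ≤ l) (hf0 : 0 ≤ f) (hf1 : f ≤ 1) (m : ℕ) :
    (zMeasure l (Set.Iic (m + f))).toReal =
      ∑ j ∈ Finset.range m, poissonWeight l j + f * poissonWeight l m := by
  have hw : ∀ j, 0 ≤ poissonWeight l j := fun j => by unfold poissonWeight; positivity
  have hS : MeasurableSet ((fun p : ℝ × ℝ => p.1 + p.2) ⁻¹' Set.Iic ((m : ℝ) + f)) :=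
    measurableSet_Iic.preimage (by fun_prop)
  have hvol : ∀ j : ℕ, (volume.restrict (Set.Ioo (0 : ℝ) 1))
      (Prod.mk (j : ℝ) ⁻¹' ((fun p : ℝ × ℝ => p.1 + p.2) ⁻¹' Set.Iic ((m : ℝ) + f))) =
      if j < m then 1 else if j = m then ENNReal.ofReal f else 0 := by
    intro j
    have hset : Prod.mk (j : ℝ) ⁻¹' ((fun p : ℝ × ℝ => p.1 + p.2) ⁻¹' Set.Iic ((m : ℝ) + f)) =
        Set.Iic (m + f - j) := by
      ext u
      simp only [Set.mem_preimage, Set.mem_Iic]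
      exact le_sub_iff_add_le'.symm
    rw [hset, Measure.restrict_apply measurableSet_Iic]
    split_ifs with h1 h2
    · have : (j : ℝ) + 1 ≤ m := by exact_mod_cast h1
      rw [Set.inter_eq_right.2, Real.volume_Ioo]
      · simp
      · intro u hu
        simp only [Set.mem_Iic]
        linarith [hu.2]
    · subst h2
      have : (Set.Iic ((j : ℝ) + f - j) ∩ Set.Ioo 0 1 : Set ℝ) =ᵐ[volume] Set.Ioc 0 f := by
        rw [add_sub_cancel_left]
        have hI : (Set.Iic f ∩ Set.Ioc 0 1 : Set ℝ) = Set.Ioc 0 f := by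
          ext u
          simp only [Set.mem_inter_iff, Set.mem_Iic, Set.mem_Ioc]
          exact ⟨fun h => ⟨h.2.1, h.1⟩, fun h => ⟨h.2, h.1, h.2.trans hf1⟩⟩
        exact ((ae_eq_refl (Set.Iic f)).inter Ioo_ae_eq_Ioc).trans
          (Filter.EventuallyEq.of_eq hI)
      rw [measure_congr this, Real.volume_Ioc, sub_zero]
    · have : (m : ℝ) + 1 ≤ j := by exact_mod_cast (by omega : m + 1 ≤ j)
      rw [Set.disjoint_iff_inter_eq_empty.1, measure_empty]
      refine Set.disjoint_left.2 fun u hu hu' => ?_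
      simp only [Set.mem_Iic] at hu
      linarith [hu'.1]
  have key : zMeasure l (Set.Iic (m + f)) = ∑ j ∈ Finset.range (m + 1),
      ENNReal.ofReal (poissonWeight l j) *
        (if j < m then 1 else if j = m then ENNReal.ofReal f else 0) := by
    rw [zMeasure, Measure.map_apply (by fun_prop) measurableSet_Iic, Measure.prod_apply hS,
      lintegral_map (measurable_measure_prodMk_left hS) .of_discrete, poissonMeasure,
      lintegral_sum_measure, tsum_eq_sum (s := Finset.range (m + 1))]
    · refine Finset.sum_congr rfl fun j _ => ?_
      rw [lintegral_smul_measure, lintegral_dirac, hvol, smul_eq_mul, Real.coe_toNNReal l hl,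
        poissonWeight]
    · intro j hj
      rw [Finset.mem_range] at hj
      rw [lintegral_smul_measure, lintegral_dirac, hvol, if_neg (by omega), if_neg (by omega),
        smul_zero]
  rw [key, Finset.sum_range_succ, if_neg (lt_irrefl m), if_pos rfl,
    Finset.sum_congr rfl (g := fun j => ENNReal.ofReal (poissonWeight l j)) fun j hj => by
      rw [if_pos (Finset.mem_range.1 hj), mul_one],
    ← ENNReal.ofReal_sum_of_nonneg fun j _ => hw j, ← ENNReal.ofReal_mul (hw m),
    ← ENNReal.ofReal_add (Finset.sum_nonneg fun j _ => hw j) (mul_nonneg (hw m) hf0),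
    ENNReal.toReal_ofReal (add_nonneg (Finset.sum_nonneg fun j _ => hw j) (mul_nonneg (hw m) hf0)),
    mul_comm f]

lemma hasDerivAt_sum_poissonWeight (n : ℕ) (u : ℝ) :
    HasDerivAt (fun u => ∑ j ∈ Finset.range (n + 1), poissonWeight u j) (-poissonWeight u n) u := by
  induction n with
  | zero =>
    simpa [poissonWeight] using (hasDerivAt_neg u).exp
  | succ n ih =>
    simp_rw [Finset.sum_range_succ _ (n + 1)]
    have h : HasDerivAt (fun u => poissonWeight u (n + 1))
        (poissonWeight u n - poissonWeight u (n + 1)) u := by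
      unfold poissonWeight
      refine (((hasDerivAt_neg u).exp.mul (hasDerivAt_pow (n + 1) u)).div_const _).congr_deriv ?_
      rw [Nat.factorial_succ]
      push_cast
      field_simp
      ring
    exact (ih.add h).congr_deriv (by ring)

lemma sum_poissonWeight_add_one_sub (n : ℕ) (l : ℝ) :
    ∑ j ∈ Finset.range (n + 1), poissonWeight (l + 1) j -
      ∑ j ∈ Finset.range (n + 1), poissonWeight l j =
      -∫ v in (0 : ℝ)..1, poissonWeight (l + v) n := by
  have hc : Continuous fun u => poissonWeight u n := by unfold poissonWeight; fun_prop
  rw [intervalIntegral.integral_comp_add_left (fun u => poissonWeight u n), add_zero,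
    ← intervalIntegral.integral_neg]
  exact (intervalIntegral.integral_eq_sub_of_hasDerivAt
    (fun u _ => hasDerivAt_sum_poissonWeight n u) (hc.neg.intervalIntegrable _ _)).symm

lemma factorial_div_g_mul_poissonWeight {n : ℕ} {x : ℝ} (hx : 0 ≤ x) (v : ℝ) :
    ((n + 1).factorial : ℝ) / g (n + 1) ((n : ℝ) + 1 + x) * poissonWeight (n + x + v) (n + 1) =
      c n v x := by
  have hM : (n : ℝ) + 1 + x ≠ 0 := by positivity
  rw [g, poissonWeight, c, div_pow, show 1 - v = -(n + x + v) - -((n : ℝ) + 1 + x) by ring,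
    Real.exp_sub, show (n : ℝ) + x + v = n + v + x by ring]
  field_simp

lemma poissonWeight_succ (l : ℝ) (n : ℕ) :
    poissonWeight l (n + 1) = poissonWeight l n * l / (n + 1) := by
  rw [poissonWeight, poissonWeight, Nat.factorial_succ]
  push_cast
  field_simp
  ring

lemma c_one {n : ℕ} {x : ℝ} (hx : 0 ≤ x) : c n 1 x = 1 := by
  have hM : (n : ℝ) + 1 + x ≠ 0 := by positivity
  simp [c, div_self hM]

lemma factorial_div_g_mul_sum_sub {n : ℕ} {x : ℝ} (hx : 0 ≤ x) :
    ((n + 1).factorial : ℝ) / g (n + 1) ((n : ℝ) + 1 + x) *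
      (∑ j ∈ Finset.range (n + 2), poissonWeight (n + x + 1) j -
        ∑ j ∈ Finset.range (n + 2), poissonWeight (n + x) j) = -∫ v in (0 : ℝ)..1, c n v x := by
  rw [sum_poissonWeight_add_one_sub (n + 1), mul_neg, ← intervalIntegral.integral_const_mul]
  simp_rw [factorial_div_g_mul_poissonWeight hx]

lemma Δfun_eq_of_lower {n : ℕ} {x k : ℝ} (hn : 1 ≤ n) (hx : 0 ≤ x)
    (h : x + 1 / 3 + k / (n + x) ∈ Set.Icc (0 : ℝ) 1)
    (h' : x + 1 / 3 + k / (n + 1 + x) ∈ Set.Icc (0 : ℝ) 1) :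
    Δfun n x k = -1 + c n 0 x * (1 + (n + 1) / (n + x)) - (∫ v in (0 : ℝ)..1, c n v x) +
      (x + 1 / 3 + k / (n + 1 + x)) -
      (x + 1 / 3 + k / (n + x)) * ((n + 1) / (n + x)) * c n 0 x := by
  have hn' : (1 : ℝ) ≤ n := by exact_mod_cast hn
  have hl : (n : ℝ) + x ≠ 0 := by positivity
  have h1 := factorial_div_g_mul_sum_sub (n := n) hx
  have h2 := factorial_div_g_mul_poissonWeight (n := n) hx 0
  have h3 := factorial_div_g_mul_poissonWeight (n := n) hx 1
  rw [c_one hx] at h3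
  rw [add_zero] at h2
  have h4 : poissonWeight (n + x) n = poissonWeight (n + x) (n + 1) * ((n + 1) / (n + x)) := by
    rw [poissonWeight_succ]
    field_simp
  have e1 : w n x k = ∑ j ∈ Finset.range n, poissonWeight (n + x) j +
      (x + 1 / 3 + k / (n + x)) * poissonWeight (n + x) n := by
    rw [← zMeasure_Iic_toReal (by positivity) h.1 h.2, w]
    ring_nf
  have e2 : w (n + 1) x k = ∑ j ∈ Finset.range (n + 1), poissonWeight (n + x + 1) j +
      (x + 1 / 3 + k / (n + 1 + x)) * poissonWeight (n + x + 1) (n + 1) := by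
    rw [← zMeasure_Iic_toReal (by positivity) h'.1 h'.2, w]
    push_cast
    ring_nf
  rw [Finset.sum_range_succ, Finset.sum_range_succ (fun j => poissonWeight (n + x) j),
    Finset.sum_range_succ (fun j => poissonWeight (n + x) j), h4] at h1
  rw [Δfun, e1, e2, h4]
  linear_combination h1 + (x + 1 / 3 + k / (n + 1 + x) - 1) * h3 +
    (1 + (n + 1) / (n + x) - (x + 1 / 3 + k / (n + x)) * ((n + 1) / (n + x))) * h2

lemma Δfun_eq_of_upper {n : ℕ} {x k : ℝ} (hx : 0 ≤ x)
    (h : x + 1 / 3 + k / (n + x) ∈ Set.Icc (1 : ℝ) 2)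
    (h' : x + 1 / 3 + k / (n + 1 + x) ∈ Set.Icc (1 : ℝ) 2) :
    Δfun n x k = c n 0 x - (∫ v in (0 : ℝ)..1, c n v x) +
      (x - 2 / 3 + k / (n + 1 + x)) * ((n + 1 + x) / (n + 2)) -
      (x - 2 / 3 + k / (n + x)) * c n 0 x := by
  have h1 := factorial_div_g_mul_sum_sub (n := n) hx
  have h2 := factorial_div_g_mul_poissonWeight (n := n) hx 0
  have h3 := factorial_div_g_mul_poissonWeight (n := n) hx 1
  rw [c_one hx] at h3
  rw [add_zero] at h2
  have h4 : poissonWeight (n + x + 1) (n + 2) =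
      poissonWeight (n + x + 1) (n + 1) * ((n + 1 + x) / (n + 2)) := by
    rw [poissonWeight_succ _ (n + 1)]
    push_cast
    ring
  have e1 : w n x k = ∑ j ∈ Finset.range (n + 1), poissonWeight (n + x) j +
      (x - 2 / 3 + k / (n + x)) * poissonWeight (n + x) (n + 1) := by
    rw [← zMeasure_Iic_toReal (by positivity) (by linarith [h.1]) (by linarith [h.2]), w]
    push_cast
    ring_nf
  have e2 : w (n + 1) x k = ∑ j ∈ Finset.range (n + 2), poissonWeight (n + x + 1) j +
      (x - 2 / 3 + k / (n + 1 + x)) * poissonWeight (n + x + 1) (n + 2) := by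
    rw [← zMeasure_Iic_toReal (by positivity) (by linarith [h'.1]) (by linarith [h'.2]), w]
    push_cast
    ring_nf
  rw [Finset.sum_range_succ (fun j => poissonWeight (n + x) j)] at h1
  rw [Δfun, e1, e2, h4]
  linear_combination h1 + (x - 2 / 3 + k / (n + 1 + x)) * ((n + 1 + x) / (n + 2)) * h3 +
    (1 - (x - 2 / 3 + k / (n + x))) * h2

lemma abs_exp_sub_expansion_le {a b e E : ℝ} (he0 : 0 < e) (he3 : e ≤ 1 / 3) (ha : |a| ≤ 1)
    (hb : |b| ≤ 1) (hE : |E| ≤ 3 * e ^ 3) :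
    |Real.exp (a * e + b * e ^ 2 + E) - (1 + a * e + (b + a ^ 2 / 2) * e ^ 2)| ≤
      13 * e ^ 3 := by
  obtain ⟨L, hL⟩ : ∃ L, L = a * e + b * e ^ 2 + E := ⟨_, rfl⟩
  have he23 : 3 * e ^ 3 ≤ e ^ 2 := by
    have : e ^ 2 * e ≤ e ^ 2 * (1 / 3) := mul_le_mul_of_nonneg_left he3 (by positivity)
    linarith
  have he12 : e ^ 2 * 3 ≤ e := by
    have : e * e ≤ e * (1 / 3) := mul_le_mul_of_nonneg_left he3 he0.le
    linarith
  have hLa : |L - a * e| ≤ 2 * e ^ 2 := by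
    have h1 : |b * e ^ 2| ≤ e ^ 2 := by
      rw [abs_mul, abs_of_pos (pow_pos he0 2)]
      exact mul_le_of_le_one_left (by positivity) hb
    rw [show L - a * e = b * e ^ 2 + E by rw [hL]; ring]
    linarith [abs_add_le (b * e ^ 2) E]
  have hae : |a * e| ≤ e := by
    rw [abs_mul, abs_of_pos he0]
    exact mul_le_of_le_one_left he0.le ha
  have hL3 : |L| ≤ 3 * e := by
    have := abs_add_le (L - a * e) (a * e)
    rw [sub_add_cancel] at this
    linarith
  have hexp : |Real.exp L - (1 + L + L ^ 2 / 2)| ≤ 6 * e ^ 3 := by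
    have h := Real.exp_bound (x := L) (by linarith) (n := 3) (by norm_num)
    norm_num [Finset.sum_range_succ, Nat.factorial] at h
    have h3 : |L| ^ 3 ≤ (3 * e) ^ 3 := pow_le_pow_left₀ (abs_nonneg _) hL3 3
    rw [mul_pow] at h3
    linarith
  have hsq : |(L - a * e) * (L + a * e) / 2| ≤ 4 * e ^ 3 := by
    have h1 : |L + a * e| ≤ 4 * e := by linarith [abs_add_le L (a * e)]
    rw [abs_div, abs_mul, abs_two]
    have := mul_le_mul hLa h1 (abs_nonneg _) (by positivity)
    linarith
  have hsum : Real.exp L - (1 + a * e + (b + a ^ 2 / 2) * e ^ 2) =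
      (Real.exp L - (1 + L + L ^ 2 / 2)) + (L - a * e) * (L + a * e) / 2 + E := by
    linear_combination hL
  rw [← hL, hsum]
  linarith [abs_add_three (Real.exp L - (1 + L + L ^ 2 / 2)) ((L - a * e) * (L + a * e) / 2) E]

lemma abs_log_one_sub_add_cubic_le {y : ℝ} (hy0 : 0 ≤ y) (hy : y ≤ 1 / 3) :
    |y + y ^ 2 / 2 + y ^ 3 / 3 + Real.log (1 - y)| ≤ 2 * y ^ 4 := by
  have h := Real.abs_log_sub_add_sum_range_le (x := y) (by rw [abs_of_nonneg hy0]; linarith) 3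
  rw [abs_of_nonneg hy0] at h
  have h' : y ^ (3 + 1) / (1 - y) ≤ 2 * y ^ 4 := by
    rw [div_le_iff₀ (by linarith)]
    have : y ^ 4 * (1 / 2) ≤ y ^ 4 * (1 - y) :=
      mul_le_mul_of_nonneg_left (by linarith) (by positivity)
    norm_num
    linarith
  refine le_trans (le_of_eq ?_) (h.trans h')
  norm_num [Finset.sum_range_succ]

lemma abs_c_sub_expansion_le {n : ℕ} {x s : ℝ} (hx : x ∈ Set.Icc (0 : ℝ) 1)
    (hs : s ∈ Set.Icc (0 : ℝ) 1) (hn : 2 ≤ n) :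
    |c n (1 - s) x - (1 + (x * s - s ^ 2 / 2) / (n + 1 + x) +
      (x * s ^ 2 / 2 - s ^ 3 / 3 + (x * s - s ^ 2 / 2) ^ 2 / 2) / (n + 1 + x) ^ 2)| ≤
      13 / ((n : ℝ) + 1 + x) ^ 3 := by
  obtain ⟨hx0, hx1⟩ := hx
  obtain ⟨hs0, hs1⟩ := hs
  have hn' : (2 : ℝ) ≤ n := by exact_mod_cast hn
  have hM : (n : ℝ) + 1 + x ≠ 0 := by positivity
  obtain ⟨e, he⟩ : ∃ e : ℝ, e = ((n : ℝ) + 1 + x)⁻¹ := ⟨_, rfl⟩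
  have he0 : 0 < e := by rw [he]; positivity
  have he3 : e ≤ 1 / 3 := by
    rw [he, inv_le_comm₀ (by positivity) (by norm_num)]
    linarith
  have heM : (n + 1 + x) * e = 1 := by rw [he]; exact mul_inv_cancel₀ hM
  have hy0 : 0 ≤ s * e := by positivity
  have hye : s * e ≤ e := mul_le_of_le_one_left he0.le hs1
  have hxs0 : 0 ≤ x * s := by positivity
  have hxs1 : x * s ≤ 1 := mul_le_one₀ hx1 hs0 hs1
  have hs2 : s ^ 2 ≤ 1 := pow_le_one₀ hs0 hs1
  have hs3 : s ^ 3 ≤ 1 := pow_le_one₀ hs0 hs1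
  have hs2' : 0 ≤ s ^ 2 := by positivity
  have hs3' : 0 ≤ s ^ 3 := by positivity
  have hxs2 : x * s ^ 2 ≤ 1 := mul_le_one₀ hx1 hs2' hs2
  have hxs3 : x * s ^ 3 ≤ 1 := mul_le_one₀ hx1 hs3' hs3
  have hxs2' : 0 ≤ x * s ^ 2 := by positivity
  have ha : |x * s - s ^ 2 / 2| ≤ 1 := abs_le.2 ⟨by linarith, by linarith⟩
  have hb : |x * s ^ 2 / 2 - s ^ 3 / 3| ≤ 1 := abs_le.2 ⟨by linarith, by linarith⟩
  obtain ⟨δ, hδ⟩ : ∃ δ, δ = s * e + (s * e) ^ 2 / 2 + (s * e) ^ 3 / 3 + Real.log (1 - s * e) :=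
    ⟨_, rfl⟩
  have hδ1 : |δ| ≤ 2 * e ^ 4 := by
    have := pow_le_pow_left₀ hy0 hye 4
    have h := abs_log_one_sub_add_cubic_le hy0 (hye.trans he3)
    rw [hδ]
    linarith
  have hE : |x * s ^ 3 / 3 * e ^ 3 + (n + 1) * δ| ≤ 3 * e ^ 3 := by
    have h1 : |x * s ^ 3 / 3 * e ^ 3| ≤ e ^ 3 := by
      rw [abs_of_nonneg (by positivity)]
      exact mul_le_of_le_one_left (by positivity) (by linarith)
    have h2 : |((n : ℝ) + 1) * δ| ≤ 2 * e ^ 3 := by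
      rw [abs_mul, abs_of_nonneg (by positivity)]
      calc ((n : ℝ) + 1) * |δ| ≤ (n + 1 + x) * (2 * e ^ 4) :=
            mul_le_mul (by linarith) hδ1 (abs_nonneg _) (by positivity)
        _ = 2 * e ^ 3 := by linear_combination 2 * e ^ 3 * heM
    linarith [abs_add_le (x * s ^ 3 / 3 * e ^ 3) ((n + 1) * δ)]
  have hc : c n (1 - s) x = Real.exp (s + (n + 1) * Real.log (1 - s * e)) := by
    have hpos : 0 < 1 - s * e := by linarith
    rw [Real.exp_add, mul_comm, c, show 1 - (1 - s) = s by ring]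
    congr 1
    rw [show ((n : ℝ) + 1) = ((n + 1 : ℕ) : ℝ) by push_cast; ring, ← Real.log_pow,
      Real.exp_log (pow_pos hpos _), he]
    push_cast
    congr 1
    field_simp
    ring
  have hL : s + (n + 1) * Real.log (1 - s * e) = (x * s - s ^ 2 / 2) * e +
      (x * s ^ 2 / 2 - s ^ 3 / 3) * e ^ 2 + (x * s ^ 3 / 3 * e ^ 3 + (n + 1) * δ) := by
    rw [hδ]
    linear_combination (-s - s ^ 2 / 2 * e - s ^ 3 / 3 * e ^ 2) * heM
  simp only [div_eq_mul_inv _ ((n : ℝ) + 1 + x), div_eq_mul_inv _ (((n : ℝ) + 1 + x) ^ _),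
    ← inv_pow, ← he]
  rw [hc, hL]
  exact abs_exp_sub_expansion_le he0 he3 ha hb hE

lemma abs_integral_c_sub_expansion_le {n : ℕ} {x : ℝ} (hx : x ∈ Set.Icc (0 : ℝ) 1) (hn : 2 ≤ n) :
    |(∫ v in (0 : ℝ)..1, c n v x) - (1 + (x / 2 - 1 / 6) / (n + 1 + x) +
      (x / 6 - 1 / 12 + (x ^ 2 / 3 - x / 4 + 1 / 20) / 2) / (n + 1 + x) ^ 2)| ≤
      13 / ((n : ℝ) + 1 + x) ^ 3 := by
  set M : ℝ := (n : ℝ) + 1 + x with hM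
  have hpoly : (∫ s in (0 : ℝ)..1, (1 + (x * s - s ^ 2 / 2) / M +
      (x * s ^ 2 / 2 - s ^ 3 / 3 + (x * s - s ^ 2 / 2) ^ 2 / 2) / M ^ 2)) =
      1 + (x / 2 - 1 / 6) / M +
        (x / 6 - 1 / 12 + (x ^ 2 / 3 - x / 4 + 1 / 20) / 2) / M ^ 2 := by
    rw [intervalIntegral.integral_eq_sub_of_hasDerivAt (f := fun s => s +
      (x / 2 * s ^ 2 - 1 / 6 * s ^ 3) / M + (x / 6 * s ^ 3 - 1 / 12 * s ^ 4 +
        (x ^ 2 / 3 * s ^ 3 - x / 4 * s ^ 4 + 1 / 20 * s ^ 5) / 2) / M ^ 2)]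
    · ring
    · intro s _
      have hp : ∀ (m : ℕ) (y : ℝ), HasDerivAt (fun s : ℝ => y * s ^ m) (y * (m * s ^ (m - 1))) s :=
        fun m y => (hasDerivAt_pow m s).const_mul y
      refine (((hasDerivAt_id s).add (((hp 2 _).sub (hp 3 _)).div_const M)).add
        ((((hp 3 _).sub (hp 4 _)).add
          ((((hp 3 _).sub (hp 4 _)).add (hp 5 _)).div_const 2)).div_const (M ^ 2))).congr_deriv ?_
      norm_num
      ring
    · exact Continuous.intervalIntegrable (by fun_prop) _ _
  have hrefl : (∫ v in (0 : ℝ)..1, c n v x) = ∫ s in (0 : ℝ)..1, c n (1 - s) x := by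
    rw [intervalIntegral.integral_comp_sub_left (fun v => c n v x)]
    norm_num
  have hcont : Continuous fun s => c n (1 - s) x := by unfold c; fun_prop
  rw [← hpoly, hrefl, ← intervalIntegral.integral_sub (hcont.intervalIntegrable _ _)
    (Continuous.intervalIntegrable (by fun_prop) _ _), ← Real.norm_eq_abs]
  refine (intervalIntegral.norm_integral_le_of_norm_le_const (C := 13 / M ^ 3)
    fun s hs => ?_).trans (by norm_num)
  rw [Set.uIoc_of_le zero_le_one] at hs
  exact abs_c_sub_expansion_le hx ⟨hs.1.le, hs.2⟩ hn

/-- The numerator of the remainder in the second-order expansion of `Δ_n` for `x + 1/3 + r < 1`. -/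
noncomputable def lowerRemainder (x k e R S : ℝ) : ℝ :=
  -S + 5 / 3 * R - x * R +
    e * (7 / 36 + 13 / 72 * x - 25 / 24 * x ^ 2 + 1 / 6 * x ^ 3 + 1 / 2 * x ^ 4 -
      43 / 24 * k - 1 / 2 * x * k + 1 / 2 * x ^ 2 * k + 2 * S - 8 / 3 * R + 1 / 3 * x * R +
      x ^ 2 * R - k * R) +
    e ^ 2 * (-7 / 36 - 13 / 72 * x + 25 / 24 * x ^ 2 - 1 / 6 * x ^ 3 - 1 / 2 * x ^ 4 +
      3 / 2 * k - 5 / 24 * x * k + 1 / 2 * x ^ 3 * k - S + R + 2 / 3 * x * R - x ^ 2 * R +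
      x * k * R)

/-- The numerator of the remainder in the second-order expansion of `Δ_n` for `x + 1/3 + r ≥ 1`. -/
noncomputable def upperRemainder (x k e R S : ℝ) : ℝ :=
  -S + 5 / 3 * R - x * R +
    e * (2 / 3 - 3 * x + 5 * x ^ 2 - 11 / 3 * x ^ 3 + x ^ 4 + 17 / 24 * k - 3 * x * k +
      1 / 2 * x ^ 2 * k + x * S - 5 / 3 * x * R + x ^ 2 * R - k * R) +
    e ^ 2 * (-2 / 3 + 3 * x - 5 * x ^ 2 + 11 / 3 * x ^ 3 - x ^ 4 - 31 / 24 * k +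
      31 / 24 * x * k - 1 / 2 * x ^ 2 * k + 1 / 2 * x ^ 3 * k + S - x * S - 5 / 3 * R +
      8 / 3 * x * R - x ^ 2 * R - k * R + x * k * R)

lemma lower_expansion {M x k c₀ I R S : ℝ} (hM : 1 < M)
    (hR : R = M ^ 2 * (c₀ - (1 + (x - 1 / 2) / M + (x / 2 - 1 / 3 + (x - 1 / 2) ^ 2 / 2) / M ^ 2)))
    (hS : S = M ^ 2 * (I - (1 + (x / 2 - 1 / 6) / M +
      (x / 6 - 1 / 12 + (x ^ 2 / 3 - x / 4 + 1 / 20) / 2) / M ^ 2))) :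
    M ^ 2 * (-1 + c₀ * (1 + (M - x) / (M - 1)) - I + (x + 1 / 3 + k / M) -
      (x + 1 / 3 + k / (M - 1)) * ((M - x) / (M - 1)) * c₀ -
      3 / (2 * M ^ 2) * (x ^ 2 * (x - 1) / 3 + 4 / 135 - k)) =
      lowerRemainder x k M⁻¹ R S / (1 - M⁻¹) ^ 2 := by
  have h0 : M ≠ 0 := by positivity
  have h1 : M - 1 ≠ 0 := by linarith
  have hc : c₀ = 1 + (x - 1 / 2) / M + (x / 2 - 1 / 3 + (x - 1 / 2) ^ 2 / 2) / M ^ 2 +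
      R / M ^ 2 := by
    rw [hR]; field_simp; ring
  have hI : I = 1 + (x / 2 - 1 / 6) / M +
      (x / 6 - 1 / 12 + (x ^ 2 / 3 - x / 4 + 1 / 20) / 2) / M ^ 2 + S / M ^ 2 := by
    rw [hS]; field_simp; ring
  have h2 : 1 - M⁻¹ = (M - 1) / M := by field_simp
  rw [h2, hc, hI, lowerRemainder]
  field_simp
  ring

lemma upper_expansion {M x k c₀ I R S : ℝ} (hM : 1 < M) (hx : x ≤ 1)
    (hR : R = M ^ 2 * (c₀ - (1 + (x - 1 / 2) / M + (x / 2 - 1 / 3 + (x - 1 / 2) ^ 2 / 2) / M ^ 2)))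
    (hS : S = M ^ 2 * (I - (1 + (x / 2 - 1 / 6) / M +
      (x / 6 - 1 / 12 + (x ^ 2 / 3 - x / 4 + 1 / 20) / 2) / M ^ 2))) :
    M ^ 2 * (c₀ - I + (x - 2 / 3 + k / M) * (M / (M + 1 - x)) - (x - 2 / 3 + k / (M - 1)) * c₀ -
      3 / (2 * M ^ 2) * (x / 3 * (x ^ 2 - 4 * x + 5) - 86 / 135 - k)) =
      upperRemainder x k M⁻¹ R S / ((1 - M⁻¹) * (1 + (1 - x) * M⁻¹)) := by
  have h0 : M ≠ 0 := by positivity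
  have h1 : M - 1 ≠ 0 := by linarith
  have h3 : M + 1 - x ≠ 0 := by linarith
  have hc : c₀ = 1 + (x - 1 / 2) / M + (x / 2 - 1 / 3 + (x - 1 / 2) ^ 2 / 2) / M ^ 2 +
      R / M ^ 2 := by
    rw [hR]; field_simp; ring
  have hI : I = 1 + (x / 2 - 1 / 6) / M +
      (x / 6 - 1 / 12 + (x ^ 2 / 3 - x / 4 + 1 / 20) / 2) / M ^ 2 + S / M ^ 2 := by
    rw [hS]; field_simp; ring
  have h2 : 1 - M⁻¹ = (M - 1) / M := by field_simp
  have h4 : 1 + (1 - x) * M⁻¹ = (M + 1 - x) / M := by field_simp; ring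
  rw [h2, h4, hc, hI, upperRemainder]
  field_simp
  ring


lemma tendsto_natCast_add_atTop (a : ℝ) : Tendsto (fun n : ℕ => (n : ℝ) + a) atTop atTop :=
  tendsto_atTop_add_const_right _ _ tendsto_natCast_atTop_atTop

lemma tendsto_inv_shift (x : ℝ) :
    Tendsto (fun n : ℕ => ((n : ℝ) + 1 + x)⁻¹) atTop (nhds 0) := by
  simpa only [add_assoc, Function.comp_def] using
    tendsto_inv_atTop_zero.comp (tendsto_natCast_add_atTop (1 + x))

lemma tendsto_sq_mul_of_abs_le {x C : ℝ} (hx : 0 ≤ x) {f : ℕ → ℝ}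
    (hf : ∀ᶠ n : ℕ in atTop, |f n| ≤ C / ((n : ℝ) + 1 + x) ^ 3) :
    Tendsto (fun n : ℕ => ((n : ℝ) + 1 + x) ^ 2 * f n) atTop (nhds 0) := by
  have h : Tendsto (fun n : ℕ => C * ((n : ℝ) + 1 + x)⁻¹) atTop (nhds 0) := by
    simpa using (tendsto_inv_shift x).const_mul C
  refine squeeze_zero_norm' ?_ h
  filter_upwards [hf] with n hn
  have hM : 0 < (n : ℝ) + 1 + x := by positivity
  rw [Real.norm_eq_abs, abs_mul, abs_of_pos (pow_pos hM 2)]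
  refine (mul_le_mul_of_nonneg_left hn (by positivity)).trans (le_of_eq ?_)
  field_simp

lemma tendsto_c_zero_remainder {x : ℝ} (hx : x ∈ Set.Icc (0 : ℝ) 1) :
    Tendsto (fun n : ℕ => ((n : ℝ) + 1 + x) ^ 2 *
      (c n 0 x - (1 + (x - 1 / 2) / (n + 1 + x) +
        (x / 2 - 1 / 3 + (x - 1 / 2) ^ 2 / 2) / (n + 1 + x) ^ 2))) atTop (nhds 0) := by
  refine tendsto_sq_mul_of_abs_le (C := 13) hx.1 ?_
  filter_upwards [eventually_ge_atTop 2] with n hn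
  simpa using abs_c_sub_expansion_le hx (s := 1) ⟨zero_le_one, le_rfl⟩ hn

lemma tendsto_integral_c_remainder {x : ℝ} (hx : x ∈ Set.Icc (0 : ℝ) 1) :
    Tendsto (fun n : ℕ => ((n : ℝ) + 1 + x) ^ 2 *
      ((∫ v in (0 : ℝ)..1, c n v x) - (1 + (x / 2 - 1 / 6) / (n + 1 + x) +
        (x / 6 - 1 / 12 + (x ^ 2 / 3 - x / 4 + 1 / 20) / 2) / (n + 1 + x) ^ 2)))
      atTop (nhds 0) := by
  refine tendsto_sq_mul_of_abs_le (C := 13) hx.1 ?_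
  filter_upwards [eventually_ge_atTop 2] with n hn
  exact abs_integral_c_sub_expansion_le hx hn

lemma tendsto_Δfun_of_lower {k x : ℝ} (hx : x ∈ Set.Icc (0 : ℝ) 1)
    (h : ∀ᶠ n : ℕ in atTop, x + 1 / 3 + k / (n + x) ∈ Set.Icc (0 : ℝ) 1) :
    Tendsto (fun n : ℕ => ((n : ℝ) + 1 + x) ^ 2 * (Δfun n x k -
      3 / (2 * ((n : ℝ) + 1 + x) ^ 2) * (x ^ 2 * (x - 1) / 3 + 4 / 135 - k)))
      atTop (nhds 0) := by
  have hcont : Continuous fun p : ℝ × ℝ × ℝ => lowerRemainder x k p.1 p.2.1 p.2.2 := by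
    unfold lowerRemainder
    fun_prop
  have hlim := (hcont.tendsto (0, 0, 0)).comp ((tendsto_inv_shift x).prodMk_nhds
    ((tendsto_c_zero_remainder hx).prodMk_nhds (tendsto_integral_c_remainder hx)))
  have hden := ((tendsto_inv_shift x).const_sub 1).pow 2
  have hq := hlim.div hden (by norm_num)
  rw [show lowerRemainder x k (0, 0, 0).1 (0, 0, 0).2.1 (0, 0, 0).2.2 / (1 - 0) ^ 2 = 0 by
    simp [lowerRemainder]] at hq
  refine hq.congr' ?_
  filter_upwards [h, (tendsto_add_atTop_nat 1).eventually h, eventually_ge_atTop 1]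
    with n h1 h2 hn
  have hn' : (1 : ℝ) ≤ n := by exact_mod_cast hn
  push_cast at h2
  have key := lower_expansion (M := (n : ℝ) + 1 + x) (k := k) (x := x) (by linarith [hx.1])
    (c₀ := c n 0 x) (I := ∫ v in (0 : ℝ)..1, c n v x) rfl rfl
  rw [show (n : ℝ) + 1 + x - 1 = n + x by ring, show (n : ℝ) + 1 + x - x = n + 1 by ring] at key
  rw [Δfun_eq_of_lower hn hx.1 h1 h2]
  exact key.symm

lemma tendsto_Δfun_of_upper {k x : ℝ} (hx : x ∈ Set.Icc (0 : ℝ) 1)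
    (h : ∀ᶠ n : ℕ in atTop, x + 1 / 3 + k / (n + x) ∈ Set.Icc (1 : ℝ) 2) :
    Tendsto (fun n : ℕ => ((n : ℝ) + 1 + x) ^ 2 * (Δfun n x k -
      3 / (2 * ((n : ℝ) + 1 + x) ^ 2) * (x / 3 * (x ^ 2 - 4 * x + 5) - 86 / 135 - k)))
      atTop (nhds 0) := by
  have hcont : Continuous fun p : ℝ × ℝ × ℝ => upperRemainder x k p.1 p.2.1 p.2.2 := by
    unfold upperRemainder
    fun_prop
  have hlim := (hcont.tendsto (0, 0, 0)).comp ((tendsto_inv_shift x).prodMk_nhds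
    ((tendsto_c_zero_remainder hx).prodMk_nhds (tendsto_integral_c_remainder hx)))
  have hden := ((tendsto_inv_shift x).const_sub 1).mul
    (((tendsto_inv_shift x).const_mul (1 - x)).const_add 1)
  have hq := hlim.div hden (by norm_num)
  rw [show upperRemainder x k (0, 0, 0).1 (0, 0, 0).2.1 (0, 0, 0).2.2 /
    ((1 - 0) * (1 + (1 - x) * 0)) = 0 by simp [upperRemainder]] at hq
  refine hq.congr' ?_
  filter_upwards [h, (tendsto_add_atTop_nat 1).eventually h, eventually_ge_atTop 1]
    with n h1 h2 hn
  have hn' : (1 : ℝ) ≤ n := by exact_mod_cast hn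
  push_cast at h2
  have key := upper_expansion (M := (n : ℝ) + 1 + x) (k := k) (x := x) (by linarith [hx.1]) hx.2
    (c₀ := c n 0 x) (I := ∫ v in (0 : ℝ)..1, c n v x) rfl rfl
  rw [show (n : ℝ) + 1 + x - 1 = n + x by ring, show (n : ℝ) + 1 + x + 1 - x = n + 2 by ring]
    at key
  rw [Δfun_eq_of_upper hx.1 h1 h2]
  exact key.symm

theorem lemma3 (k x : ℝ) (hx : x ∈ Set.Ico (0 : ℝ) 1) :
    Tendsto (fun n : ℕ => (n : ℝ) ^ 2 *
      (Δfun n x k - 3 / (2 * ((n : ℝ) + 1 + x) ^ 2) * (Hfun x - k)))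
      atTop (nhds 0) := by
  have hx' : x ∈ Set.Icc (0 : ℝ) 1 := ⟨hx.1, hx.2.le⟩
  suffices h : Tendsto (fun n : ℕ => ((n : ℝ) + 1 + x) ^ 2 *
      (Δfun n x k - 3 / (2 * ((n : ℝ) + 1 + x) ^ 2) * (Hfun x - k))) atTop (nhds 0) by
    refine squeeze_zero_norm (fun n => ?_) (by simpa only [norm_zero] using h.norm)
    have := hx.1
    rw [norm_mul, norm_mul (((n : ℝ) + 1 + x) ^ 2), Real.norm_of_nonneg (sq_nonneg (n : ℝ)),
      Real.norm_of_nonneg (sq_nonneg ((n : ℝ) + 1 + x))]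
    gcongr
    linarith
  have hr : Tendsto (fun n : ℕ => k / ((n : ℝ) + x)) atTop (nhds 0) :=
    (tendsto_natCast_add_atTop x).const_div_atTop k
  have hy : Tendsto (fun n : ℕ => x + 1 / 3 + k / ((n : ℝ) + x)) atTop (nhds (x + 1 / 3)) := by
    simpa using hr.const_add (x + 1 / 3)
  have hy0 := hy.eventually (eventually_ge_nhds (b := 0) (by linarith [hx.1]))
  have hy2 := hy.eventually (eventually_le_nhds (b := 2) (by linarith [hx.2]))
  have hH : x = 2 / 3 → Hfun x = x / 3 * (x ^ 2 - 4 * x + 5) - 86 / 135 := by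
    rintro rfl
    norm_num [Hfun]
  rcases lt_trichotomy x (2 / 3) with hlt | heq | hgt
  · rw [Hfun, if_pos hlt.le]
    exact tendsto_Δfun_of_lower hx' (hy0.and
      (hy.eventually (eventually_le_nhds (by linarith))))
  · rcases lt_or_ge k 0 with hk | hk
    · rw [Hfun, if_pos heq.le]
      refine tendsto_Δfun_of_lower hx' (hy0.and (Eventually.of_forall fun n => ?_))
      have : k / ((n : ℝ) + x) ≤ 0 :=
        div_nonpos_of_nonpos_of_nonneg hk.le (add_nonneg n.cast_nonneg hx.1)
      linarith
    · rw [hH heq]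
      refine tendsto_Δfun_of_upper hx' (Eventually.and (Eventually.of_forall fun n => ?_) hy2)
      have : 0 ≤ k / ((n : ℝ) + x) := div_nonneg hk (add_nonneg n.cast_nonneg hx.1)
      linarith
  · rw [Hfun, if_neg hgt.not_ge]
    exact tendsto_Δfun_of_upper hx' (Eventually.and
      (hy.eventually (eventually_ge_nhds (by linarith))) hy2)
end

section
/- With σ_λ defined by 1/σ_λ = 2·P(N_λ = ⌊Me_{Z_λ}⌋), one has σ_λ ~ √(πλ/2) as λ → ∞; that is, 2·√(πλ/2)·P(N_λ = ⌊Me_{Z_λ}⌋) → 1 as λ → ∞. -/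
open MeasureTheory ProbabilityTheory Filter Real Set
open scoped ENNReal NNReal

/-- The probability that a Poisson variable with parameter `x` is at most `n`, as a function
of the real number `x`. -/
noncomputable def poissonCdf (n : ℕ) (x : ℝ) : ℝ :=
  ∑ k ∈ Finset.range (n + 1), exp (-x) * x ^ k / (k.factorial : ℝ)

theorem poissonMeasure_real_Iic {x : ℝ} (hx : 0 ≤ x) (n : ℕ) :
    (poissonMeasure x.toNNReal).real (Iic n) = poissonCdf n x := by
  have h : (Iic n : Set ℕ) = (Finset.range (n + 1) : Finset ℕ) := by
    ext k; simp
  rw [h, ← sum_measureReal_singleton, poissonCdf]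
  simp [poissonMeasure_real_singleton, Real.coe_toNNReal x hx]

theorem poissonCdf_nonneg {x : ℝ} (hx : 0 ≤ x) (n : ℕ) : 0 ≤ poissonCdf n x :=
  Finset.sum_nonneg fun _ _ => by positivity

theorem poissonCdf_le_one {x : ℝ} (hx : 0 ≤ x) (n : ℕ) : poissonCdf n x ≤ 1 := by
  rw [← poissonMeasure_real_Iic hx]
  exact measureReal_le_one

theorem poissonCdf_zero (n : ℕ) : poissonCdf n 0 = 1 := by
  rw [poissonCdf, Finset.sum_range_succ']
  simp

theorem hasDerivAt_poissonCdf (n : ℕ) (x : ℝ) :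
    HasDerivAt (poissonCdf n) (-(exp (-x) * x ^ n / (n.factorial : ℝ))) x := by
  induction n with
  | zero =>
    have h : poissonCdf 0 = fun y => exp (-y) := by
      ext y; simp [poissonCdf]
    rw [h]
    simpa using (hasDerivAt_neg x).exp
  | succ n ih =>
    have h : poissonCdf (n + 1) = fun y => poissonCdf n y +
        exp (-y) * y ^ (n + 1) / ((n + 1).factorial : ℝ) := by
      ext y; rw [poissonCdf, Finset.sum_range_succ]; rfl
    rw [h]
    have h1 := ih.add
      ((((hasDerivAt_neg x).exp).mul (hasDerivAt_pow (n + 1) x)).div_const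
        ((n + 1).factorial : ℝ))
    convert! h1 using 1
    have h2 : (n.factorial : ℝ) ≠ 0 := by positivity
    rw [Nat.factorial_succ]
    push_cast
    have h3 : (n : ℝ) + 1 ≠ 0 := by positivity
    field_simp
    ring

theorem antitoneOn_poissonCdf (n : ℕ) : AntitoneOn (poissonCdf n) (Ici 0) := by
  refine antitoneOn_of_hasDerivWithinAt_nonpos (convex_Ici 0)
    (fun x _ => (hasDerivAt_poissonCdf n x).continuousAt.continuousWithinAt)
    (fun x _ => (hasDerivAt_poissonCdf n x).hasDerivWithinAt) fun x hx => ?_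
  have hx' : 0 ≤ x := interior_subset hx
  have : 0 ≤ exp (-x) * x ^ n / (n.factorial : ℝ) := by positivity
  linarith

theorem exp_two_mul_le_div {s : ℝ} (h0 : 0 ≤ s) (h1 : s < 1) :
    exp (2 * s) ≤ (1 + s) / (1 - s) := by
  have h := Real.sum_range_le_log_div h0 h1 1
  simp only [Finset.sum_range_one] at h
  norm_num at h
  rw [← Real.le_log_iff_exp_le (div_pos (by linarith) (by linarith))]
  linarith

theorem exp_mul_pow_sub_le_add {n : ℕ} (hn : 0 < n) {t : ℝ} (h0 : 0 ≤ t) (h1 : t < n) :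
    exp (-(n - t)) * (n - t) ^ n ≤ exp (-(n + t)) * (n + t) ^ n := by
  have hn' : (0 : ℝ) < n := by exact_mod_cast hn
  have hb : exp (2 * (t / n)) * (n - t) ≤ n + t := by
    have h := exp_two_mul_le_div (s := t / n) (by positivity) ((div_lt_one hn').2 h1)
    have h2 : (1 + t / n) / (1 - t / n) = (n + t) / (n - t) := by
      have : (n : ℝ) - t ≠ 0 := by linarith
      field_simp
    rw [h2] at h
    exact (le_div_iff₀ (by linarith)).1 h
  have hp := pow_le_pow_left₀ (mul_nonneg (exp_pos _).le (by linarith)) hb n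
  have he : exp (-((n : ℝ) - t)) = exp (-(n + t)) * exp (2 * (t / n)) ^ n := by
    rw [← Real.exp_nat_mul, ← Real.exp_add]
    congr 1
    field_simp
    ring
  rw [mul_pow] at hp
  calc exp (-(n - t)) * (n - t) ^ n
      = exp (-(n + t)) * (exp (2 * (t / n)) ^ n * (n - t) ^ n) := by rw [he]; ring
    _ ≤ _ := mul_le_mul_of_nonneg_left hp (exp_pos _).le

theorem half_le_poissonCdf_self {n : ℕ} (hn : 0 < n) : 1 / 2 ≤ poissonCdf n n := by
  have hd (t : ℝ) : HasDerivAt (fun t => poissonCdf n (n + t) + poissonCdf n (n - t))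
      (-(exp (-(n + t)) * (n + t) ^ n / (n.factorial : ℝ)) +
        exp (-(n - t)) * (n - t) ^ n / (n.factorial : ℝ)) t := by
    have h1 := (hasDerivAt_poissonCdf n (n + t)).comp t ((hasDerivAt_id t).const_add (n : ℝ))
    have h2 := (hasDerivAt_poissonCdf n (n - t)).comp t ((hasDerivAt_id t).const_sub (n : ℝ))
    convert! h1.add h2 using 1
    ring
  have ha : AntitoneOn (fun t => poissonCdf n (n + t) + poissonCdf n (n - t))
      (Icc (0 : ℝ) n) := by
    refine antitoneOn_of_hasDerivWithinAt_nonpos (convex_Icc _ _)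
      (fun t _ => (hd t).continuousAt.continuousWithinAt)
      (fun t _ => (hd t).hasDerivWithinAt) fun t ht => ?_
    rw [interior_Icc] at ht
    have h := div_le_div_of_nonneg_right (exp_mul_pow_sub_le_add hn ht.1.le ht.2)
      (c := (n.factorial : ℝ)) (by positivity)
    linarith
  have h := ha (left_mem_Icc.2 n.cast_nonneg) (right_mem_Icc.2 n.cast_nonneg) n.cast_nonneg
  simp only [add_zero, sub_zero, sub_self, poissonCdf_zero] at h
  have := poissonCdf_nonneg (x := n + n) (by positivity) n
  linarith

theorem half_le_poissonCdf {n : ℕ} (hn : 0 < n) {x : ℝ} (h0 : 0 ≤ x) (hx : x ≤ n) :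
    1 / 2 ≤ poissonCdf n x :=
  (half_le_poissonCdf_self hn).trans (antitoneOn_poissonCdf n h0 (h0.trans hx) hx)

theorem poisson_reflect_le {n : ℕ} {x : ℝ} (hx : (n : ℝ) ≤ x) :
    ∀ {j : ℕ}, j < n → exp (-x) * x ^ (n - 1 - j) / ((n - 1 - j).factorial : ℝ) ≤
      exp (-x) * x ^ (n + j) / ((n + j).factorial : ℝ) := by
  have hx0 : 0 ≤ x := n.cast_nonneg.trans hx
  intro j
  induction j with
  | zero =>
    intro hn
    obtain ⟨m, rfl⟩ : ∃ m, n = m + 1 := ⟨n - 1, by omega⟩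
    simp only [Nat.add_sub_cancel, Nat.sub_zero, Nat.add_zero, Nat.factorial_succ]
    push_cast at hx ⊢
    rw [div_le_div_iff₀ (by positivity) (by positivity), pow_succ]
    have : 0 ≤ exp (-x) * x ^ m * (m.factorial : ℝ) := by positivity
    nlinarith [mul_le_mul_of_nonneg_left hx this]
  | succ j ih =>
    intro hj
    have h := ih (by omega)
    obtain ⟨m, rfl⟩ : ∃ m, n = m + j + 2 := ⟨n - j - 2, by omega⟩
    have e1 : m + j + 2 - 1 - j = m + 1 := by omega
    have e2 : m + j + 2 - 1 - (j + 1) = m := by omega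
    rw [e1] at h
    rw [e2, ← add_assoc]
    set k := m + j + 2 + j with hk
    rw [Nat.factorial_succ] at h ⊢
    have hx1 : 0 < x := by push_cast at hx; linarith [(m.cast_nonneg : (0 : ℝ) ≤ m),
      (j.cast_nonneg : (0 : ℝ) ≤ j)]
    have hq : ((m : ℝ) + 1) * (k + 1) ≤ x * x := by
      have : ((m + j + 2 : ℕ) : ℝ) * ((m + j + 2 : ℕ) : ℝ) ≤ x * x :=
        mul_le_mul hx hx (Nat.cast_nonneg _) hx0
      rw [hk]
      push_cast at this ⊢
      nlinarith [(m.cast_nonneg : (0 : ℝ) ≤ m), (j.cast_nonneg : (0 : ℝ) ≤ j)]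
    push_cast at h ⊢
    calc exp (-x) * x ^ m / (m.factorial : ℝ)
        = exp (-x) * x ^ (m + 1) / (((m : ℝ) + 1) * m.factorial) * ((m + 1) / x) := by
          field_simp
          ring
      _ ≤ exp (-x) * x ^ k / (k.factorial : ℝ) * (x / (k + 1)) := by
          refine mul_le_mul h ?_ (by positivity) (by positivity)
          rwa [div_le_div_iff₀ hx1 (by positivity)]
      _ = exp (-x) * x ^ (k + 1) / (((k : ℝ) + 1) * k.factorial) := by
          field_simp
          ring

theorem poissonCdf_le_half {n : ℕ} {x : ℝ} (hx : (n + 1 : ℝ) ≤ x) :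
    poissonCdf n x ≤ 1 / 2 := by
  have hx' : ((n + 1 : ℕ) : ℝ) ≤ x := by exact_mod_cast hx
  have hx0 : 0 ≤ x := (Nat.cast_nonneg _).trans hx'
  have h1 : poissonCdf n x ≤ ∑ j ∈ Finset.range (n + 1),
      exp (-x) * x ^ (n + 1 + j) / ((n + 1 + j).factorial : ℝ) := by
    rw [poissonCdf, ← Finset.sum_range_reflect]
    exact Finset.sum_le_sum fun j hj => poisson_reflect_le hx' (Finset.mem_range.1 hj)
  have h2 := poissonCdf_le_one hx0 (n + 1 + n)
  rw [poissonCdf, add_assoc (n + 1) n 1, Finset.sum_range_add] at h2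
  rw [poissonCdf] at h1 ⊢
  linarith

theorem poissonCdf_lt_half {n : ℕ} {x : ℝ} (hx : (n + 2 : ℝ) ≤ x) :
    poissonCdf n x < 1 / 2 := by
  have h := poissonCdf_le_half (n := n + 1) (x := x) (by push_cast; linarith)
  have hx0 : 0 < x := by linarith [(n.cast_nonneg : (0 : ℝ) ≤ n)]
  have h2 : poissonCdf (n + 1) x = poissonCdf n x +
      exp (-x) * x ^ (n + 1) / ((n + 1).factorial : ℝ) := by
    rw [poissonCdf, Finset.sum_range_succ]; rfl
  have : 0 < exp (-x) * x ^ (n + 1) / ((n + 1).factorial : ℝ) := by positivity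
  linarith

theorem zMeasure_Iic (l t : ℝ) :
    zMeasure l (Iic t) = ((poissonMeasure l.toNNReal).map (Nat.cast : ℕ → ℝ)).prod
      (volume.restrict (Ioo (0 : ℝ) 1)) {p | p.1 + p.2 ≤ t} := by
  rw [zMeasure, Measure.map_apply (by fun_prop) measurableSet_Iic]
  rfl

theorem poissonMeasure_map_cast_Iic (r : ℝ≥0) (n : ℕ) :
    (poissonMeasure r).map (Nat.cast : ℕ → ℝ) (Iic (n : ℝ)) = poissonMeasure r (Iic n) := by
  rw [Measure.map_apply .of_discrete measurableSet_Iic]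
  congr 1
  ext k
  simp

theorem poissonMeasure_Iic_le_zMeasure (l : ℝ) (n : ℕ) :
    poissonMeasure l.toNNReal (Iic n) ≤ zMeasure l (Iic (n + 1 : ℝ)) := by
  rw [zMeasure_Iic]
  have h : ((poissonMeasure l.toNNReal).map (Nat.cast : ℕ → ℝ)).prod
      (volume.restrict (Ioo (0 : ℝ) 1)) (Iic (n : ℝ) ×ˢ Iic 1) =
      poissonMeasure l.toNNReal (Iic n) := by
    rw [Measure.prod_prod, poissonMeasure_map_cast_Iic,
      Measure.restrict_apply measurableSet_Iic, inter_eq_right.2 fun y hy => hy.2.le]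
    simp
  rw [← h]
  exact measure_mono fun p hp =>
    show p.1 + p.2 ≤ n + 1 from add_le_add hp.1 hp.2

theorem zMeasure_le_poissonMeasure_Iic (l : ℝ) {n : ℕ} {t : ℝ} (ht : t < n + 1) :
    zMeasure l (Iic t) ≤ poissonMeasure l.toNNReal (Iic n) := by
  rw [zMeasure_Iic]
  set μ := (poissonMeasure l.toNNReal).map (Nat.cast : ℕ → ℝ) with hμ
  have hU : volume.restrict (Ioo (0 : ℝ) 1) (Iic 0) = 0 := by
    rw [Measure.restrict_apply measurableSet_Iic,
      (disjoint_iff_inter_eq_empty.1 (disjoint_left.2 fun y hy hy' => hy'.1.not_ge hy) :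
        Iic (0 : ℝ) ∩ Ioo 0 1 = ∅), measure_empty]
  have hsub : {p : ℝ × ℝ | p.1 + p.2 ≤ t} ⊆ Iic t ×ˢ univ ∪ univ ×ˢ Iic 0 := by
    intro p hp
    rcases le_or_gt p.2 0 with h | h
    · exact Or.inr ⟨mem_univ _, h⟩
    · refine Or.inl ⟨?_, mem_univ _⟩
      have : p.1 + p.2 ≤ t := hp
      exact mem_Iic.2 (by linarith)
  have hN : μ (Iic t) ≤ poissonMeasure l.toNNReal (Iic n) := by
    rw [hμ, Measure.map_apply .of_discrete measurableSet_Iic]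
    refine measure_mono fun k hk => ?_
    have hk' : (k : ℝ) ≤ t := hk
    have : (k : ℝ) < (n + 1 : ℕ) := by push_cast; linarith
    exact Nat.lt_succ_iff.1 (by exact_mod_cast this)
  calc _ ≤ _ := measure_mono hsub
    _ ≤ _ := measure_union_le _ _
    _ = μ (Iic t) := by
      rw [Measure.prod_prod, Measure.prod_prod, hU]
      simp
    _ ≤ _ := hN

theorem half_le_poissonMeasure_Iic_iff {l : ℝ} (hl : 0 ≤ l) (n : ℕ) :
    (1 : ℝ≥0∞) / 2 ≤ poissonMeasure l.toNNReal (Iic n) ↔ 1 / 2 ≤ poissonCdf n l := by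
  rw [← poissonMeasure_real_Iic hl, measureReal_def,
    ← ENNReal.toReal_le_toReal (by simp) (measure_ne_top _ _)]
  simp

theorem sub_three_le_of_half_le_zMeasure {l t : ℝ} (hl : 3 ≤ l)
    (ht : (1 : ℝ≥0∞) / 2 ≤ zMeasure l (Iic t)) : l - 3 ≤ t := by
  by_contra! hlt
  obtain ⟨n, hn⟩ : ∃ n : ℕ, ⌊l⌋₊ = n + 2 :=
    ⟨⌊l⌋₊ - 2, by have : 2 ≤ ⌊l⌋₊ := Nat.le_floor (by push_cast; linarith); omega⟩
  have h1 := Nat.floor_le (by linarith : 0 ≤ l)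
  have h2 := Nat.lt_floor_add_one l
  rw [hn] at h1 h2
  push_cast at h1 h2
  have h3 := (half_le_poissonMeasure_Iic_iff (by linarith) n).1
    (ht.trans (zMeasure_le_poissonMeasure_Iic l (n := n) (by linarith)))
  exact absurd (poissonCdf_lt_half h1) h3.not_gt

theorem half_le_zMeasure_add_two {l : ℝ} (hl : 0 < l) :
    (1 : ℝ≥0∞) / 2 ≤ zMeasure l (Iic (l + 2)) := by
  have h1 := Nat.ceil_lt_add_one hl.le
  refine ((half_le_poissonMeasure_Iic_iff hl.le ⌈l⌉₊).2
    (half_le_poissonCdf (Nat.ceil_pos.2 hl) hl.le (Nat.le_ceil l))).trans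
    ((poissonMeasure_Iic_le_zMeasure l _).trans (measure_mono (Iic_subset_Iic.2 ?_)))
  linarith

theorem medianZ_mem_Icc {l : ℝ} (hl : 3 ≤ l) : medianZ l ∈ Icc (l - 3) (l + 2) :=
  ⟨le_csInf ⟨_, half_le_zMeasure_add_two (by linarith)⟩
      fun _ ht => sub_three_le_of_half_le_zMeasure hl ht,
    csInf_le ⟨l - 3, fun _ ht => sub_three_le_of_half_le_zMeasure hl ht⟩
      (half_le_zMeasure_add_two (by linarith))⟩

theorem abs_floor_medianZ_sub_le {l : ℝ} (hl : 4 ≤ l) :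
    |(⌊medianZ l⌋.toNat : ℝ) - l| ≤ 4 := by
  obtain ⟨h1, h2⟩ := medianZ_mem_Icc (by linarith : 3 ≤ l)
  have h3 := Int.floor_le (medianZ l)
  have h4 := Int.lt_floor_add_one (medianZ l)
  have h5 : 0 ≤ ⌊medianZ l⌋ := Int.floor_nonneg.2 (by linarith)
  have h6 : (⌊medianZ l⌋.toNat : ℝ) = (⌊medianZ l⌋ : ℝ) := by
    exact_mod_cast congrArg (Int.cast : ℤ → ℝ) (Int.toNat_of_nonneg h5)
  rw [h6, abs_le]
  constructor <;> linarith

/-- The local limit theorem for the Poisson law at integers a bounded distance from the mean. -/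
theorem tendsto_sqrt_mul_poisson_of_abs_sub_le {m : ℝ → ℕ} {C : ℝ}
    (hm : ∀ᶠ l in atTop, |(m l : ℝ) - l| ≤ C) :
    Tendsto (fun l : ℝ => √(2 * π * l) * (exp (-l) * l ^ m l / ((m l).factorial : ℝ)))
      atTop (nhds 1) := by
  have hmR : Tendsto (fun l => (m l : ℝ)) atTop atTop := by
    refine tendsto_atTop_mono' _ ?_ (tendsto_atTop_add_const_right atTop (-C) tendsto_id)
    filter_upwards [hm] with l hl
    have := (abs_le.1 hl).1
    simp only [id]
    linarith
  have hmN : Tendsto m atTop atTop := tendsto_natCast_atTop_iff.1 hmR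
  have hst : Tendsto (fun l => √π / Stirling.stirlingSeq (m l)) atTop (nhds 1) := by
    have := (tendsto_const_nhds (x := √π)).div
      (Stirling.tendsto_stirlingSeq_sqrt_pi.comp hmN) (by positivity)
    rwa [div_self (by positivity)] at this
  have hratio : Tendsto (fun l : ℝ => √(l / m l)) atTop (nhds 1) := by
    have h0 : Tendsto (fun l : ℝ => (l - m l) / m l) atTop (nhds 0) := by
      refine squeeze_zero_norm' ?_ (hmR.const_div_atTop C)
      filter_upwards [hm] with l hl
      rw [norm_div, Real.norm_eq_abs, Real.norm_eq_abs, Nat.abs_cast, abs_sub_comm]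
      gcongr
    have h1 : Tendsto (fun l : ℝ => l / m l) atTop (nhds 1) := by
      have := h0.add_const 1
      rw [zero_add] at this
      refine this.congr' ?_
      filter_upwards [hmR.eventually_gt_atTop 0] with l hl
      field_simp
      ring
    simpa using h1.sqrt
  have hexp : Tendsto (fun l : ℝ => exp (m l - l + m l * log (l / m l))) atTop (nhds 1) := by
    rw [← Real.exp_zero]
    refine (Real.continuous_exp.tendsto 0).comp ?_
    have hlow : Tendsto (fun l : ℝ => -(C ^ 2 / l)) atTop (nhds 0) := by
      simpa using (tendsto_id.const_div_atTop (C ^ 2)).neg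
    refine tendsto_of_tendsto_of_tendsto_of_le_of_le' hlow tendsto_const_nhds ?_ ?_
    · filter_upwards [hm, hmR.eventually_gt_atTop 0, eventually_gt_atTop 0] with l hl hml hl0
      have h := mul_le_mul_of_nonneg_left
        (Real.one_sub_inv_le_log_of_pos (div_pos hl0 hml)) hml.le
      have h2 : ((m l : ℝ) - l) ^ 2 / l ≤ C ^ 2 / l := by
        refine div_le_div_of_nonneg_right ?_ hl0.le
        exact sq_le_sq' (abs_le.1 hl).1 (abs_le.1 hl).2
      have h3 : (m l : ℝ) - l + m l * (1 - (l / m l)⁻¹) = -(((m l : ℝ) - l) ^ 2 / l) := by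
        field_simp
        ring
      linarith
    · filter_upwards [hmR.eventually_gt_atTop 0, eventually_gt_atTop 0] with l hml hl0
      have h := mul_le_mul_of_nonneg_left
        (Real.log_le_sub_one_of_pos (div_pos hl0 hml)) hml.le
      have h3 : (m l : ℝ) * (l / m l - 1) = l - m l := by
        field_simp
      linarith
  have hprod := (hst.mul hratio).mul hexp
  rw [one_mul, one_mul] at hprod
  refine hprod.congr' ?_
  filter_upwards [hmR.eventually_gt_atTop 0, eventually_gt_atTop 0] with l hml hl0
  have e1 : exp (m l - l + m l * log (l / m l)) =
      exp 1 ^ m l * exp (-l) * (l ^ m l / (m l : ℝ) ^ m l) := by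
    rw [Real.exp_add, sub_eq_add_neg, Real.exp_add, Real.exp_nat_mul,
      Real.exp_log (div_pos hl0 hml), div_pow, ← Real.exp_nat_mul, mul_one]
  have e2 : √(2 * π * l) = √2 * √π * √l := by
    rw [Real.sqrt_mul (by positivity), Real.sqrt_mul (by positivity)]
  rw [e1, e2, Stirling.stirlingSeq, Real.sqrt_div hl0.le, Real.sqrt_mul (by positivity), div_pow]
  have h1 : √(m l : ℝ) ≠ 0 := by positivity
  have h2 : ((m l).factorial : ℝ) ≠ 0 := by positivity
  have h3 : (m l : ℝ) ^ m l ≠ 0 := by positivity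
  field_simp

theorem sigma_lambda_asymptotics :
    Tendsto (fun l : ℝ => 2 * Real.sqrt (π * l / 2) *
      (poissonMeasure l.toNNReal {(⌊medianZ l⌋).toNat}).toReal)
      atTop (nhds 1) := by
  have h := tendsto_sqrt_mul_poisson_of_abs_sub_le (m := fun l => ⌊medianZ l⌋.toNat) (C := 4)
    ((eventually_ge_atTop 4).mono fun l hl => abs_floor_medianZ_sub_le hl)
  refine h.congr' ?_
  filter_upwards [eventually_gt_atTop 0] with l hl
  rw [← measureReal_def, poissonMeasure_real_singleton, Real.coe_toNNReal l hl.le]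
  congr 1
  rw [show 2 * π * l = 2 ^ 2 * (π * l / 2) by ring, Real.sqrt_mul (by positivity),
    Real.sqrt_sq (by positivity)]
end
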